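/- arXiv:2507.12740 — 2 statements merged into one kernel-verified Lean document; each statement's English description precedes it below -/
import Mathlib

section
/- In the bipartite random clustering setup, for every T ⊆ V(G) with |T ∩ V_j| ≤ 1 for each j ∈ [2], and every i ∈ [m'], the probability that δ_{1}(G[D_i ∪ T]) + δ_{2}(G[D_i ∪ T]) < (1 + ε/2)·|D_i|/2 is less than exp(−Cε²/8). -/
/-- Index of the interval containing `x` (1-based): `W_1 = [0, r)`, and for `i ≥ 2`,
`W_i` is the `(i-1)`-st interval of length `w` after that. -/
def clusterIndex (r w x : ℕ) : ℕ := if x < r then 1 else (x - r) / w + 2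

open Classical in
/-- Uniform probability, over a pair of independent uniformly random permutations,
of the event `E`. -/
noncomputable def permProb (N M : ℕ)
    (E : Equiv.Perm (Fin N) × Equiv.Perm (Fin M) → Prop) : ℝ :=
  (((Finset.univ : Finset (Equiv.Perm (Fin N) × Equiv.Perm (Fin M))).filter E).card : ℝ) /
    ((Finset.univ : Finset (Equiv.Perm (Fin N) × Equiv.Perm (Fin M))).card : ℝ)

/-- One side of the `i`-th random cluster `D_i`: the set of `j` with `π j` in the `i`-th
interval, where the first interval has length `r = (C-1)C + (n mod (C-1)C)` and the later
ones length `C-1`. -/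
def bipCluster (n C i : ℕ) (π : Equiv.Perm (Fin n)) : Finset (Fin n) :=
  Finset.univ.filter fun v =>
    clusterIndex ((C - 1) * C + n % ((C - 1) * C)) (C - 1) (π v).val = i

/-- The number `m'` of clusters. -/
def numClustersBip (n C : ℕ) : ℕ :=
  (n - ((C - 1) * C + n % ((C - 1) * C))) / (C - 1) + 1

open Finset

lemma card_perm_extending_le {α : Type*} [Fintype α] [DecidableEq α] (W : Finset α)
    (x : W → α) :
    #{p : Equiv.Perm α | (fun w : W => p w) = x} ≤ (Fintype.card α - #W).factorial := by
  classical
  by_cases hx : Function.Injective x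
  · let e : (W : Set α) ≃ Set.range x := Equiv.ofInjective x hx
    have hcard : Fintype.card {p : Equiv.Perm α // ∀ w : (W : Set α), p w = e w} =
        (Fintype.card α - #W).factorial := by
      rw [Fintype.card_congr (Equiv.Set.compl e)]
      have hW : Fintype.card ((W : Set α)ᶜ : Set α) = Fintype.card α - #W := by
        rw [Fintype.card_compl_set]; simp
      have hR : Fintype.card ((Set.range x)ᶜ : Set α) = Fintype.card α - #W := by
        rw [Fintype.card_compl_set, Set.card_range_of_injective hx]; simp
      rw [Fintype.card_equiv (Fintype.equivOfCardEq (hW.trans hR.symm)), hW]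
    rw [← hcard, Fintype.card_subtype]
    refine card_le_card fun p hp => ?_
    simp only [mem_filter, mem_univ, true_and] at hp ⊢
    intro w
    exact congrFun hp w
  · rw [card_eq_zero.2]
    · exact Nat.zero_le _
    · refine filter_eq_empty_iff.2 fun p _ hp => hx ?_
      rw [← hp]
      exact p.injective.comp Subtype.val_injective

lemma pow_mul_factorial_sub_le {n s : ℕ} (hn : 2 * s ^ 2 ≤ n) :
    (n : ℝ) ^ s * (n - s).factorial ≤ 2 * n.factorial := by
  rcases Nat.eq_zero_or_pos s with rfl | hs
  · simp only [pow_zero, one_mul, Nat.sub_zero]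
    have : (0 : ℝ) ≤ n.factorial := by positivity
    linarith
  have hsn : s ≤ n := by nlinarith
  have hn0 : (0 : ℝ) < n := by exact_mod_cast hs.trans_le hsn
  have hdesc : ((n : ℝ) - s) ^ s ≤ n.descFactorial s := by
    have h := Nat.pow_sub_le_descFactorial n s
    calc ((n : ℝ) - s) ^ s = ((n - s : ℕ) : ℝ) ^ s := by rw [Nat.cast_sub hsn]
      _ ≤ ((n + 1 - s : ℕ) : ℝ) ^ s := by gcongr; omega
      _ ≤ _ := by exact_mod_cast h
  have hbern : (1 : ℝ) / 2 ≤ (1 + -(s / n : ℝ)) ^ s := by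
    have hle : (s : ℝ) / n ≤ 1 := by
      rw [div_le_one hn0]; exact_mod_cast hsn
    refine le_trans ?_ (one_add_mul_le_pow (by linarith) s)
    have : (s : ℝ) * (s / n) ≤ 1 / 2 := by
      rw [← mul_div_assoc, div_le_iff₀ hn0]
      have : (2 * s ^ 2 : ℝ) ≤ n := by exact_mod_cast hn
      nlinarith
    linarith
  have hpow : (n : ℝ) ^ s ≤ 2 * n.descFactorial s := by
    have heq : ((n : ℝ) - s) ^ s = (n : ℝ) ^ s * (1 + -(s / n : ℝ)) ^ s := by
      rw [← mul_pow]; congr 1; field_simp; ring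
    have : (n : ℝ) ^ s * (1 / 2) ≤ (n : ℝ) ^ s * (1 + -(s / n : ℝ)) ^ s := by gcongr
    linarith
  have hfac : (n.factorial : ℝ) = (n - s).factorial * n.descFactorial s := by
    exact_mod_cast (Nat.factorial_mul_descFactorial hsn).symm
  rw [hfac]
  have : (0 : ℝ) ≤ (n - s).factorial := by positivity
  nlinarith

/-- The values of a random permutation on a small set are dominated, up to a factor `2`, by
independent uniform samples. -/
lemma sum_perm_restrict_le {n : ℕ} (W : Finset (Fin n)) (hn : 2 * #W ^ 2 ≤ n)
    (f : (W → Fin n) → ℝ) (hf : ∀ x, 0 ≤ f x) :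
    (n : ℝ) ^ #W * ∑ p : Equiv.Perm (Fin n), f (fun w => p w) ≤
      2 * n.factorial * ∑ x, f x := by
  have hfib : ∑ p : Equiv.Perm (Fin n), f (fun w => p w) =
      ∑ x : W → Fin n, (#{p : Equiv.Perm (Fin n) | (fun w : W => p w) = x} : ℝ) * f x := by
    rw [← sum_fiberwise univ (fun (p : Equiv.Perm (Fin n)) (w : W) => p w)]
    refine sum_congr rfl fun x _ => ?_
    rw [sum_congr rfl (g := fun _ => f x), sum_const, nsmul_eq_mul]
    intro p hp
    rw [(mem_filter.1 hp).2]
  rw [hfib, mul_sum, mul_sum]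
  refine sum_le_sum fun x _ => ?_
  rw [← mul_assoc]
  refine mul_le_mul_of_nonneg_right ?_ (hf x)
  refine le_trans ?_ (pow_mul_factorial_sub_le hn)
  have := card_perm_extending_le W x
  rw [Fintype.card_fin] at this
  gcongr

lemma sum_indicator_mul_prod_le {n : ℕ} (hn : 0 < n) {ι : Type*} [Fintype ι] [DecidableEq ι]
    (h : Fin n → ℝ) {l : ℝ} (h0 : ∀ a, Real.exp (-l) ≤ h a) (h1 : ∀ a, h a ≤ 1)
    (v : Fin n) (c : ℝ) :
    ∑ x : ι → Fin n, (c + ∑ w, if x w = v then 1 else 0) * ∏ w, h (x w) ≤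
      (c + Fintype.card ι * (Real.exp l / n)) * (∑ a, h a) ^ Fintype.card ι := by
  have hpos : ∀ a, 0 ≤ h a := fun a => (Real.exp_pos _).le.trans (h0 a)
  have hn' : (0 : ℝ) < n := by exact_mod_cast hn
  have hsum : (n : ℝ) * Real.exp (-l) ≤ ∑ a, h a := by
    have := card_nsmul_le_sum univ h (Real.exp (-l)) (fun a _ => h0 a)
    simpa using this
  have hone : (1 : ℝ) ≤ Real.exp l / n * ∑ a, h a := by
    calc (1 : ℝ) = Real.exp l / n * (n * Real.exp (-l)) := by
          rw [Real.exp_neg]; field_simp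
      _ ≤ _ := by gcongr
  have hprod : ∑ x : ι → Fin n, ∏ w, h (x w) = (∑ a, h a) ^ Fintype.card ι := by
    have := (prod_univ_sum (fun _ : ι => (univ : Finset (Fin n))) (fun _ a => h a)).symm
    rw [Fintype.piFinset_univ] at this
    rw [this, prod_const, card_univ]
  have hpin : ∀ w : ι, ∑ x : ι → Fin n, (if x w = v then 1 else 0) * ∏ w', h (x w') ≤
      Real.exp l / n * (∑ a, h a) ^ Fintype.card ι := by
    intro w
    have hfactor : ∀ x : ι → Fin n, (if x w = v then 1 else 0) * ∏ w', h (x w') =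
        ∏ w', (if w' = w then (if x w' = v then 1 else 0) else 1) * h (x w') := by
      intro x
      rw [prod_mul_distrib]
      congr 1
      rw [prod_ite_eq' univ w (fun w' => if x w' = v then (1 : ℝ) else 0)]
      simp
    have := (prod_univ_sum (fun _ : ι => (univ : Finset (Fin n)))
      (fun w' a => (if w' = w then (if a = v then (1 : ℝ) else 0) else 1) * h a)).symm
    rw [Fintype.piFinset_univ] at this
    rw [sum_congr rfl (fun x _ => hfactor x), this,
      ← mul_prod_erase univ _ (mem_univ w)]
    have hrest : ∏ w' ∈ univ.erase w,
        ∑ a, (if w' = w then (if a = v then (1 : ℝ) else 0) else 1) * h a =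
        (∑ a, h a) ^ (Fintype.card ι - 1) := by
      rw [prod_congr rfl (g := fun _ => ∑ a, h a), prod_const, card_erase_of_mem (mem_univ w),
        card_univ]
      intro w' hw'
      simp [ne_of_mem_erase hw']
    have hι : Fintype.card ι = (Fintype.card ι - 1) + 1 :=
      (Nat.sub_add_cancel (Fintype.card_pos_iff.2 ⟨w⟩)).symm
    have hS : 0 ≤ ∑ a, h a := sum_nonneg fun a _ => hpos a
    rw [hrest]
    simp only [if_true, ite_mul, one_mul, zero_mul, sum_ite_eq', mem_univ]
    conv_rhs => rw [hι, pow_succ', ← mul_assoc]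
    exact mul_le_mul_of_nonneg_right ((h1 v).trans hone) (pow_nonneg hS _)
  simp only [add_mul, sum_add_distrib, ← mul_sum, hprod]
  refine add_le_add le_rfl ?_
  simp only [sum_mul]
  rw [sum_comm]
  refine (sum_le_sum fun w _ => hpin w).trans ?_
  simp [sum_const, card_univ, nsmul_eq_mul, mul_assoc]

lemma sum_perm_weight_le {n : ℕ} (hn0 : 0 < n) (W T : Finset (Fin n)) (hn : 2 * #W ^ 2 ≤ n)
    (h : Fin n → ℝ) {l : ℝ} (h0 : ∀ a, Real.exp (-l) ≤ h a) (h1 : ∀ a, h a ≤ 1) (v : Fin n) :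
    ∑ p : Equiv.Perm (Fin n),
        (if v ∈ W.map p.toEmbedding ∪ T then 1 else 0) * ∏ a ∈ W.map p.toEmbedding, h a ≤
      2 * n.factorial * (((if v ∈ T then 1 else 0) + #W * (Real.exp l / n)) *
        ((∑ a, h a) / n) ^ #W) := by
  have hpos : ∀ a, 0 ≤ h a := fun a => (Real.exp_pos _).le.trans (h0 a)
  have hn' : (0 : ℝ) < n := by exact_mod_cast hn0
  set c : ℝ := if v ∈ T then 1 else 0 with hc
  have hc0 : 0 ≤ c := by rw [hc]; split_ifs <;> norm_num
  let f : (W → Fin n) → ℝ := fun x => (c + ∑ w, if x w = v then 1 else 0) * ∏ w, h (x w)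
  have hf : ∀ x, 0 ≤ f x := fun x =>
    mul_nonneg (add_nonneg hc0 (sum_nonneg fun w _ => by split_ifs <;> norm_num))
      (prod_nonneg fun w _ => hpos _)
  have hle : ∀ p : Equiv.Perm (Fin n),
      (if v ∈ W.map p.toEmbedding ∪ T then (1 : ℝ) else 0) * ∏ a ∈ W.map p.toEmbedding, h a ≤
        f (fun w => p w) := by
    intro p
    have hprod : ∏ a ∈ W.map p.toEmbedding, h a = ∏ w : W, h (p w) := by
      rw [prod_map]
      exact (prod_coe_sort W (fun w => h (p w))).symm
    have hnn : 0 ≤ ∏ w : W, h (p w) := prod_nonneg fun w _ => hpos _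
    rw [hprod]
    refine mul_le_mul_of_nonneg_right ?_ hnn
    have hs0 : ∀ w ∈ (univ : Finset W), (0 : ℝ) ≤ if p w = v then 1 else 0 :=
      fun w _ => by split_ifs <;> norm_num
    split_ifs with hv
    · rcases mem_union.1 hv with hv | hv
      · obtain ⟨w, hw, rfl⟩ := mem_map.1 hv
        have := single_le_sum hs0 (mem_univ (⟨w, hw⟩ : W))
        simp only [Equiv.coe_toEmbedding, if_true] at this ⊢
        linarith
      · have := sum_nonneg hs0
        have : c = 1 := by rw [hc, if_pos hv]
        linarith
    · exact add_nonneg hc0 (sum_nonneg hs0)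
  have hcomp := sum_perm_restrict_le W hn f hf
  have hind := sum_indicator_mul_prod_le (ι := W) hn0 h h0 h1 v c
  rw [Fintype.card_coe] at hind
  refine (sum_le_sum fun p _ => hle p).trans ?_
  have hnp : (0 : ℝ) < (n : ℝ) ^ #W := by positivity
  rw [div_pow, ← mul_div_assoc, ← mul_div_assoc, le_div_iff₀ hnp, mul_comm]
  exact hcomp.trans (mul_le_mul_of_nonneg_left hind (by positivity))

lemma exp_mul_half_sq_le {ε : ℝ} (hε : 0 < ε) (hε1 : ε ≤ 1) :
    Real.exp (2 * ε / 3 * (1 + ε / 2)) *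
        (1 - (1 + ε) / 2 * (1 - Real.exp (-(2 * ε / 3)))) ^ 2 ≤
      Real.exp (-(5 / 27 * ε ^ 2)) := by
  set x := ε / 3 with hx
  have hex : ε = 3 * x := by rw [hx]; ring
  have hx0 : 0 < x := by positivity
  have hx1 : x ≤ 1 / 3 := by rw [hx]; linarith
  have hB : 1 - (1 + ε) / 2 * (1 - Real.exp (-(2 * ε / 3))) =
      Real.exp (-x) * (Real.cosh x - ε * Real.sinh x) := by
    have h2 : Real.exp (-(2 * ε / 3)) = Real.exp (-x) * Real.exp (-x) := by
      rw [← Real.exp_add]; congr 1; rw [hex]; ring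
    have h3 : Real.exp (-x) * Real.exp x = 1 := by rw [← Real.exp_add]; simp
    rw [h2, Real.cosh_eq, Real.sinh_eq]
    linear_combination (-(1 - ε) / 2) * h3
  have hcs : Real.cosh x - ε * Real.sinh x ≤
      Real.exp (x ^ 2 / 2 - 3 * x ^ 2 * (1 - x ^ 2 / 2)) := by
    have hc := Real.cosh_le_exp_half_sq x
    have hs := Real.self_le_sinh_iff.2 hx0.le
    have he : 1 - x ^ 2 / 2 ≤ Real.exp (-(x ^ 2 / 2)) := by
      have := Real.add_one_le_exp (-(x ^ 2 / 2)); linarith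
    have he' := Real.add_one_le_exp (-(3 * x ^ 2 * (1 - x ^ 2 / 2)))
    have hE := Real.exp_pos (x ^ 2 / 2)
    have hmul : Real.exp (x ^ 2 / 2) * (1 - x ^ 2 / 2) ≤ 1 := by
      calc _ ≤ Real.exp (x ^ 2 / 2) * Real.exp (-(x ^ 2 / 2)) := by gcongr
        _ = 1 := by rw [← Real.exp_add]; simp
    rw [sub_eq_add_neg (x ^ 2 / 2), Real.exp_add]
    have h1 : ε * x ≤ ε * Real.sinh x := by gcongr
    have h2 := mul_le_mul_of_nonneg_left he' hE.le
    have h3 := mul_le_mul_of_nonneg_left hmul (by positivity : 0 ≤ 3 * x ^ 2)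
    have h4 : ε * x = 3 * x ^ 2 := by rw [hex]; ring
    nlinarith
  have hcs0 : 0 ≤ Real.cosh x - ε * Real.sinh x := by
    have h1 : 0 ≤ Real.sinh x := Real.sinh_nonneg_iff.2 hx0.le
    have h2 := (Real.sinh_lt_cosh x).le
    nlinarith
  rw [hB, mul_pow]
  calc _ ≤ Real.exp (2 * ε / 3 * (1 + ε / 2)) * (Real.exp (-x) ^ 2 *
        Real.exp (x ^ 2 / 2 - 3 * x ^ 2 * (1 - x ^ 2 / 2)) ^ 2) := by gcongr
    _ = Real.exp (-2 * x ^ 2 + 3 * x ^ 4) := by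
      rw [← Real.exp_nat_mul, ← Real.exp_nat_mul, ← Real.exp_add, ← Real.exp_add]
      congr 1; rw [hex]; push_cast; ring
    _ ≤ _ := by
      rw [Real.exp_le_exp, hex]
      have : x ^ 2 ≤ 1 / 9 := by nlinarith
      nlinarith [mul_nonneg (sq_nonneg x) (sub_nonneg.2 this)]

lemma eventually_union_bound_lt {ε : ℝ} (hε : 0 < ε) (L : ℝ) :
    ∀ᶠ s : ℕ in Filter.atTop, 4 * (1 + s * L) ^ 2 * Real.exp (-(5 / 27 * ε ^ 2)) ^ s <
      Real.exp (-(((s : ℝ) + 1) * ε ^ 2 / 8)) := by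
  set q : ℝ := Real.exp (-(13 / 216 * ε ^ 2)) with hq
  have hq1 : q < 1 := by
    rw [hq, Real.exp_lt_one_iff]; have := pow_pos hε 2; linarith
  have hq0 : 0 ≤ q := (Real.exp_pos _).le
  have ht : Filter.Tendsto (fun s : ℕ => 4 * (1 + s * L) ^ 2 * q ^ s) Filter.atTop (nhds 0) := by
    have h0 := tendsto_pow_atTop_nhds_zero_of_lt_one hq0 hq1
    have h1 := tendsto_pow_const_mul_const_pow_of_lt_one 1 hq0 hq1
    have h2 := tendsto_pow_const_mul_const_pow_of_lt_one 2 hq0 hq1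
    have := ((h0.const_mul 4).add (h1.const_mul (8 * L))).add (h2.const_mul (4 * L ^ 2))
    simp only [mul_zero, add_zero] at this
    refine this.congr fun s => ?_
    ring
  have hev := ht.eventually (gt_mem_nhds (Real.exp_pos (-(ε ^ 2 / 8))))
  filter_upwards [hev] with s hs
  have hsplit : Real.exp (-(5 / 27 * ε ^ 2)) ^ s = q ^ s * Real.exp (-(s * ε ^ 2 / 8)) := by
    rw [hq, ← Real.exp_nat_mul, ← Real.exp_nat_mul, ← Real.exp_add]
    congr 1; ring
  have hsplit' : Real.exp (-(((s : ℝ) + 1) * ε ^ 2 / 8)) =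
      Real.exp (-(ε ^ 2 / 8)) * Real.exp (-(s * ε ^ 2 / 8)) := by
    rw [← Real.exp_add]; congr 1; ring
  rw [hsplit, hsplit', ← mul_assoc]
  exact mul_lt_mul_of_pos_right hs (Real.exp_pos _)

lemma card_clusterIndex_eq {n C i : ℕ} (hC : 2 ≤ C) (hn : 2 * C ^ 2 ≤ n) (hi : 1 ≤ i)
    (hi' : i ≤ numClustersBip n C) :
    C - 1 ≤ #{x : Fin n |
        clusterIndex ((C - 1) * C + n % ((C - 1) * C)) (C - 1) x.val = i} ∧
      #{x : Fin n |
        clusterIndex ((C - 1) * C + n % ((C - 1) * C)) (C - 1) x.val = i} ≤ 2 * C ^ 2 := by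
  obtain ⟨w, rfl⟩ : ∃ w, C = w + 1 := ⟨C - 1, by omega⟩
  have hw : 0 < w := by omega
  unfold numClustersBip at hi'
  simp only [Nat.add_sub_cancel] at *
  have hmod := Nat.mod_lt n (Nat.mul_pos hw (Nat.succ_pos w))
  set r := w * (w + 1) + n % (w * (w + 1)) with hr
  have hrn : r ≤ 2 * (w + 1) ^ 2 := by
    have : r < 2 * (w * (w + 1)) := by rw [Nat.succ_eq_add_one] at hmod; omega
    nlinarith
  have hrw : w ≤ r := by nlinarith [Nat.zero_le (n % (w * (w + 1)))]
  have key : ∀ a b : ℕ, b ≤ n → (∀ x, clusterIndex r w x = i ↔ a ≤ x ∧ x < b) →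
      #{x : Fin n | clusterIndex r w x.val = i} = b - a := by
    intro a b hb hab
    rw [← Nat.card_Ico, ← card_map Fin.valEmbedding]
    congr 1
    ext y
    simp only [mem_map, mem_filter, mem_univ, true_and, Fin.valEmbedding_apply, mem_Ico, hab]
    constructor
    · rintro ⟨x, hx, rfl⟩; exact hx
    · intro hy; exact ⟨⟨y, by omega⟩, hy, rfl⟩
  rcases hi.eq_or_lt with rfl | hi2
  · rw [key 0 r (by omega)]
    · omega
    · intro x
      unfold clusterIndex
      generalize (x - r) / w = q
      split_ifs with h <;> simp [h]
  · obtain ⟨k, rfl⟩ : ∃ k, i = k + 2 := ⟨i - 2, by omega⟩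
    have hk : (k + 1) * w ≤ n - r := (Nat.le_div_iff_mul_le hw).1 (by omega)
    rw [key (r + k * w) (r + (k + 1) * w) (by nlinarith [Nat.sub_add_cancel (hrn.trans hn)])]
    · have : r + (k + 1) * w - (r + k * w) = w := by
        rw [add_mul, one_mul]; omega
      rw [this]
      exact ⟨le_rfl, by nlinarith⟩
    · intro x
      unfold clusterIndex
      split_ifs with h
      · constructor
        · intro h'; omega
        · rintro ⟨h', _⟩; exact absurd h (by omega)
      · rw [Nat.add_right_cancel_iff, Nat.div_eq_iff hw, add_mul, one_mul]
        omega

lemma bipCluster_eq_map (n C i : ℕ) (π : Equiv.Perm (Fin n)) :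
    bipCluster n C i π = (univ.filter fun x : Fin n =>
      clusterIndex ((C - 1) * C + n % ((C - 1) * C)) (C - 1) x.val = i).map
        π.symm.toEmbedding := by
  ext v
  simp only [bipCluster, mem_filter, mem_univ, true_and, mem_map, Equiv.coe_toEmbedding]
  constructor
  · intro h; exact ⟨π v, h, by simp⟩
  · rintro ⟨x, hx, rfl⟩; simpa using hx

lemma prod_exp_neg_indicator {α : Type*} (D : Finset α) (P : α → Prop) [DecidablePred P] (l : ℝ) :
    ∏ a ∈ D, (if P a then Real.exp (-l) else 1) = Real.exp (-(l * #{a ∈ D | P a})) := by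
  rw [prod_ite, prod_const, prod_const, one_pow, mul_one, ← Real.exp_nat_mul]
  congr 1; ring

lemma sum_exp_neg_indicator_div {n : ℕ} (hn : 0 < n) (P : Fin n → Prop) [DecidablePred P]
    (l : ℝ) :
    (∑ a, if P a then Real.exp (-l) else 1) / n =
      1 - (#{a | P a} : ℝ) / n * (1 - Real.exp (-l)) := by
  have hn' : (n : ℝ) ≠ 0 := by exact_mod_cast hn.ne'
  have hc : (#{a | P a} : ℝ) + #{a | ¬ P a} = n := by
    have := card_filter_add_card_filter_not (s := (univ : Finset (Fin n))) P
    rw [card_univ, Fintype.card_fin] at this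
    exact_mod_cast this
  rw [sum_ite, sum_const, sum_const, nsmul_eq_mul, nsmul_eq_mul]
  field_simp
  linear_combination hc

open Classical in
lemma card_bad_perm_pairs_le {ε : ℝ} (hε : 0 < ε) {n : ℕ} (hn0 : 0 < n)
    (Adj : Fin n → Fin n → Prop)
    (hdeg : ∀ a b : Fin n, (1 + ε) * n ≤ (#{b' | Adj a b'} : ℝ) + #{a' | Adj a' b})
    (W T₁ T₂ : Finset (Fin n)) (hT₁ : #T₁ ≤ 1) (hT₂ : #T₂ ≤ 1) (hn : 2 * #W ^ 2 ≤ n) :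
    (#{p : Equiv.Perm (Fin n) × Equiv.Perm (Fin n) |
        ∃ v ∈ W.map p.1.toEmbedding ∪ T₁, ∃ u ∈ W.map p.2.toEmbedding ∪ T₂,
          (#{b ∈ W.map p.2.toEmbedding ∪ T₂ | Adj v b} : ℝ) +
            #{a ∈ W.map p.1.toEmbedding ∪ T₁ | Adj a u} < (1 + ε / 2) * #W} : ℝ) ≤
      4 * (1 + #W * Real.exp (2 * ε / 3)) ^ 2 * Real.exp (-(5 / 27 * ε ^ 2)) ^ #W *
        (n.factorial * n.factorial) := by
  have hn' : (0 : ℝ) < n := by exact_mod_cast hn0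
  have hε1 : ε ≤ 1 := by
    have h := hdeg ⟨0, hn0⟩ ⟨0, hn0⟩
    have hle : ∀ P : Fin n → Prop, (#{a | P a} : ℝ) ≤ n := fun P => by
      have := card_filter_le (univ : Finset (Fin n)) P
      rw [card_univ, Fintype.card_fin] at this
      exact_mod_cast this
    have h1 := hle (fun b' => Adj ⟨0, hn0⟩ b')
    have h2 := hle (fun a' => Adj a' ⟨0, hn0⟩)
    have : (1 + ε) * n ≤ 2 * n := by linarith
    have := le_of_mul_le_mul_right this hn'
    linarith
  set l : ℝ := 2 * ε / 3 with hl
  have hl0 : 0 < l := by positivity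
  set s := #W with hs
  have hel : Real.exp (-l) ≤ 1 := Real.exp_le_one_iff.2 (by linarith)
  let g (P : Fin n → Prop) (a : Fin n) : ℝ := if P a then Real.exp (-l) else 1
  have hg0 : ∀ P a, Real.exp (-l) ≤ g P a := fun P a => by
    simp only [g]; split_ifs <;> [exact le_rfl; exact hel]
  have hg1 : ∀ P a, g P a ≤ 1 := fun P a => by
    simp only [g]; split_ifs <;> [exact hel; exact le_rfl]
  have hgpos : ∀ P a, 0 ≤ g P a := fun P a => (Real.exp_pos _).le.trans (hg0 P a)
  let F (T : Finset (Fin n)) (v : Fin n) (P : Fin n → Prop) (p : Equiv.Perm (Fin n)) : ℝ :=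
    (if v ∈ W.map p.toEmbedding ∪ T then 1 else 0) * ∏ a ∈ W.map p.toEmbedding, g P a
  have hF0 : ∀ T v P p, 0 ≤ F T v P p := fun T v P p =>
    mul_nonneg (by split_ifs <;> norm_num) (prod_nonneg fun a _ => hgpos P a)
  let K : ℝ := Real.exp (l * (1 + ε / 2) * s)
  have hmarkov : ∀ p : Equiv.Perm (Fin n) × Equiv.Perm (Fin n),
      (if ∃ v ∈ W.map p.1.toEmbedding ∪ T₁, ∃ u ∈ W.map p.2.toEmbedding ∪ T₂,
          (#{b ∈ W.map p.2.toEmbedding ∪ T₂ | Adj v b} : ℝ) +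
            #{a ∈ W.map p.1.toEmbedding ∪ T₁ | Adj a u} < (1 + ε / 2) * s then (1 : ℝ) else 0) ≤
        ∑ v, ∑ u, K * (F T₁ v (fun a => Adj a u) p.1 * F T₂ u (fun b => Adj v b) p.2) := by
    intro p
    have hterm : ∀ v u, 0 ≤
        K * (F T₁ v (fun a => Adj a u) p.1 * F T₂ u (fun b => Adj v b) p.2) :=
      fun v u => mul_nonneg (Real.exp_pos _).le (mul_nonneg (hF0 _ _ _ _) (hF0 _ _ _ _))
    split_ifs with hbad
    · obtain ⟨v, hv, u, hu, hlt⟩ := hbad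
      refine le_trans ?_ (single_le_sum (fun v _ => sum_nonneg fun u _ => hterm v u)
        (mem_univ v))
      refine le_trans ?_ (single_le_sum (fun u _ => hterm v u) (mem_univ u))
      simp only [F, g, if_pos hv, if_pos hu, one_mul, K]
      rw [prod_exp_neg_indicator, prod_exp_neg_indicator, ← Real.exp_add, ← Real.exp_add]
      refine Real.one_le_exp ?_
      have h1 : (#{b ∈ W.map p.2.toEmbedding | Adj v b} : ℝ) ≤
          #{b ∈ W.map p.2.toEmbedding ∪ T₂ | Adj v b} := by
        exact_mod_cast card_le_card (filter_subset_filter _ subset_union_left)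
      have h2 : (#{a ∈ W.map p.1.toEmbedding | Adj a u} : ℝ) ≤
          #{a ∈ W.map p.1.toEmbedding ∪ T₁ | Adj a u} := by
        exact_mod_cast card_le_card (filter_subset_filter _ subset_union_left)
      have h3 := mul_le_mul_of_nonneg_left (h1.trans (le_of_sub_nonneg (by linarith :
        (0 : ℝ) ≤ ((1 + ε / 2) * s - #{a ∈ W.map p.1.toEmbedding | Adj a u}) -
          #{b ∈ W.map p.2.toEmbedding ∪ T₂ | Adj v b}))) hl0.le
      linarith
    · exact sum_nonneg fun v _ => sum_nonneg fun u _ => hterm v u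
  let wt (T : Finset (Fin n)) (v : Fin n) : ℝ := (if v ∈ T then 1 else 0) + s * (Real.exp l / n)
  have hwt0 : ∀ T v, 0 ≤ wt T v := fun T v =>
    add_nonneg (by split_ifs <;> norm_num) (by positivity)
  have hwt : ∀ T : Finset (Fin n), #T ≤ 1 → ∑ v, wt T v ≤ 1 + s * Real.exp l := by
    intro T hT
    have hT' : (#T : ℝ) ≤ 1 := by exact_mod_cast hT
    simp only [wt, sum_add_distrib, sum_const, card_univ, Fintype.card_fin, nsmul_eq_mul,
      sum_boole, filter_univ_mem]
    have : (n : ℝ) * (s * (Real.exp l / n)) = s * Real.exp l := by field_simp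
    linarith
  let M (P : Fin n → Prop) : ℝ := (∑ a, g P a) / n
  have hM0 : ∀ P, 0 ≤ M P := fun P => div_nonneg (sum_nonneg fun a _ => hgpos P a) hn'.le
  have hside : ∀ T v P, ∑ p, F T v P p ≤ 2 * n.factorial * (wt T v * M P ^ s) :=
    fun T v P => sum_perm_weight_le hn0 W T hn (g P) (hg0 P) (hg1 P) v
  have hMM : ∀ v u, K * (M (fun a => Adj a u) ^ s * M (fun b => Adj v b) ^ s) ≤
      Real.exp (-(5 / 27 * ε ^ 2)) ^ s := by
    intro v u
    have hK : K = Real.exp (l * (1 + ε / 2)) ^ s := by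
      rw [← Real.exp_nat_mul]; simp only [K]; congr 1; ring
    rw [hK, ← mul_pow, ← mul_pow]
    have hpos := mul_nonneg (hM0 fun a => Adj a u) (hM0 fun b => Adj v b)
    refine pow_le_pow_left₀ (mul_nonneg (Real.exp_pos _).le hpos) ?_ s
    refine le_trans ?_ (exp_mul_half_sq_le hε hε1)
    refine mul_le_mul_of_nonneg_left ?_ (Real.exp_pos _).le
    have hmean : (M (fun a => Adj a u) + M (fun b => Adj v b)) / 2 ≤
        1 - (1 + ε) / 2 * (1 - Real.exp (-l)) := by
      simp only [M, g]
      rw [sum_exp_neg_indicator_div hn0, sum_exp_neg_indicator_div hn0]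
      have h1 : 1 + ε ≤ (#{b' | Adj v b'} : ℝ) / n + (#{a' | Adj a' u} : ℝ) / n := by
        rw [← add_div, le_div_iff₀ hn']; exact hdeg v u
      have h2 := mul_le_mul_of_nonneg_right h1 (sub_nonneg.2 hel)
      linarith
    calc _ ≤ ((M (fun a => Adj a u) + M (fun b => Adj v b)) / 2) ^ 2 := by
          nlinarith [sq_nonneg (M (fun a => Adj a u) - M (fun b => Adj v b))]
      _ ≤ _ := pow_le_pow_left₀
          (div_nonneg (add_nonneg (hM0 _) (hM0 _)) zero_le_two) hmean 2
  set Q := Real.exp (-(5 / 27 * ε ^ 2)) ^ s with hQ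
  have hpair : ∀ v u, ∑ p : Equiv.Perm (Fin n) × Equiv.Perm (Fin n),
      K * (F T₁ v (fun a => Adj a u) p.1 * F T₂ u (fun b => Adj v b) p.2) ≤
        4 * (n.factorial * n.factorial) * Q * (wt T₁ v * wt T₂ u) := by
    intro v u
    rw [← mul_sum, Fintype.sum_prod_type, ← sum_mul_sum]
    have h1 := hside T₁ v (fun a => Adj a u)
    have h2 := hside T₂ u (fun b => Adj v b)
    have h3 : 0 ≤ ∑ p, F T₂ u (fun b => Adj v b) p := sum_nonneg fun p _ => hF0 _ _ _ _
    have h4 : 0 ≤ 2 * (n.factorial : ℝ) * (wt T₁ v * M (fun a => Adj a u) ^ s) :=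
      mul_nonneg (by positivity) (mul_nonneg (hwt0 _ _) (pow_nonneg (hM0 _) _))
    have h5 : 0 ≤ 4 * ((n.factorial : ℝ) * n.factorial) * (wt T₁ v * wt T₂ u) :=
      mul_nonneg (by positivity) (mul_nonneg (hwt0 _ _) (hwt0 _ _))
    calc _ ≤ K * ((2 * (n.factorial : ℝ) * (wt T₁ v * M (fun a => Adj a u) ^ s)) *
          (2 * (n.factorial : ℝ) * (wt T₂ u * M (fun b => Adj v b) ^ s))) :=
          mul_le_mul_of_nonneg_left (mul_le_mul h1 h2 h3 h4) (Real.exp_pos _).le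
      _ = 4 * ((n.factorial : ℝ) * n.factorial) * (wt T₁ v * wt T₂ u) *
          (K * (M (fun a => Adj a u) ^ s * M (fun b => Adj v b) ^ s)) := by ring
      _ ≤ 4 * ((n.factorial : ℝ) * n.factorial) * (wt T₁ v * wt T₂ u) * Q :=
          mul_le_mul_of_nonneg_left (hMM v u) h5
      _ = _ := by ring
  rw [← sum_boole]
  refine (sum_le_sum fun p _ => hmarkov p).trans ?_
  rw [sum_comm, sum_congr rfl fun v _ => sum_comm]
  refine (sum_le_sum fun v _ => sum_le_sum fun u _ => hpair v u).trans ?_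
  simp only [← mul_sum]
  rw [← sum_mul]
  have h1 := mul_le_mul (hwt T₁ hT₁) (hwt T₂ hT₂) (sum_nonneg fun u _ => hwt0 _ _)
    (by positivity)
  have h2 : 0 ≤ 4 * ((n.factorial : ℝ) * n.factorial) * Q := by positivity
  have h3 := mul_le_mul_of_nonneg_left h1 h2
  linarith

open Classical in
theorem bip_cluster_inherits_degree (ε : ℝ) (hε : 0 < ε) :
    ∃ C₀ : ℕ, ∀ C : ℕ, C₀ ≤ C →
    ∃ n₀ : ℕ, ∀ n : ℕ, n₀ ≤ n →
    ∀ Adj : Fin n → Fin n → Prop,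
      (∀ a b : Fin n,
        (1 + ε) * n ≤ ((Finset.univ.filter fun b' => Adj a b').card : ℝ) +
          ((Finset.univ.filter fun a' => Adj a' b).card : ℝ)) →
    ∀ T₁ T₂ : Finset (Fin n), T₁.card ≤ 1 → T₂.card ≤ 1 →
    ∀ i : ℕ, 1 ≤ i → i ≤ numClustersBip n C →
      permProb n n (fun π =>
        ∃ v ∈ bipCluster n C i π.1 ∪ T₁, ∃ u ∈ bipCluster n C i π.2 ∪ T₂,
          (((bipCluster n C i π.2 ∪ T₂).filter fun b => Adj v b).card : ℝ) +
              (((bipCluster n C i π.1 ∪ T₁).filter fun a => Adj a u).card : ℝ) <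
            (1 + ε / 2) *
              ((((bipCluster n C i π.1).card + (bipCluster n C i π.2).card : ℕ) : ℝ) / 2)) <
        Real.exp (-((C : ℝ) * ε ^ 2 / 8)) := by
  obtain ⟨s₀, hs₀⟩ := Filter.eventually_atTop.1
    (eventually_union_bound_lt hε (Real.exp (2 * ε / 3)))
  refine ⟨s₀ + 2, fun C hC => ⟨2 * (2 * C ^ 2) ^ 2, fun n hn Adj hdeg T₁ T₂ hT₁ hT₂ i hi hi' => ?_⟩⟩
  have hCn : 2 * C ^ 2 ≤ n := by nlinarith [Nat.zero_le (C ^ 2)]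
  have hn0 : 0 < n := by nlinarith
  obtain ⟨hlo, hup⟩ := card_clusterIndex_eq (by omega) hCn hi hi'
  have hmap := bipCluster_eq_map n C i
  set W : Finset (Fin n) := univ.filter fun x : Fin n =>
    clusterIndex ((C - 1) * C + n % ((C - 1) * C)) (C - 1) x.val = i
  have hW : 2 * #W ^ 2 ≤ n := le_trans (by gcongr) hn
  have hbound := card_bad_perm_pairs_le hε hn0 Adj hdeg W T₁ T₂ hT₁ hT₂ hW
  have hlt := hs₀ #W (by omega)
  have hexp : Real.exp (-(((#W : ℝ) + 1) * ε ^ 2 / 8)) ≤ Real.exp (-((C : ℝ) * ε ^ 2 / 8)) := by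
    have : (C : ℝ) ≤ #W + 1 := by exact_mod_cast (by omega : C ≤ #W + 1)
    rw [Real.exp_le_exp]
    gcongr
  refine lt_of_le_of_lt ?_ (hlt.trans_le hexp)
  have hcard : ((univ : Finset (Equiv.Perm (Fin n) × Equiv.Perm (Fin n))).card : ℝ) =
      n.factorial * n.factorial := by
    rw [card_univ, Fintype.card_prod, Fintype.card_perm, Fintype.card_fin]
    push_cast; rfl
  unfold permProb
  rw [hcard, div_le_iff₀ (by positivity)]
  refine le_trans (le_of_eq ?_) hbound
  norm_cast
  refine card_bij' (fun p _ => (p.1.symm, p.2.symm)) (fun p _ => (p.1.symm, p.2.symm))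
    ?_ ?_ (fun _ _ => rfl) (fun _ _ => rfl)
  · intro p hp
    simp only [mem_filter, mem_univ, true_and, hmap, card_map] at hp ⊢
    convert hp using 7
    push_cast; ring
  · intro p hp
    simp only [mem_filter, mem_univ, true_and, hmap, card_map, Equiv.symm_symm] at hp ⊢
    convert hp using 7
    push_cast; ring
end

section
/- Let ℓ ∈ ℕ, 0 < ε < 1 and 1/n, 1/ℓ ≪ ε. Let G = (V_1, V_2) be a bipartite graph with |V_1| = |V_2| = n such that δ_{1}(G) + δ_{2}(G) ≥ (1 + ε)n. If A ⊆ V(G) is a vertex subset with |A ∩ V_i| = ℓ for each i ∈ [2], chosen uniformly at random among all such subsets, then for every v ∈ V_1 and u ∈ V_2, the probability that deg(v, A) + deg(u, A) < (1 + ε/2)ℓ is at most 2·exp(−ℓε²/4). -/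
/-- For `d ≤ n`, `(d choose k) / (n choose k) ≤ (d / n) ^ k`, without division. -/
theorem Nat.choose_mul_pow_le_choose_mul_pow {d n : ℕ} (h : d ≤ n) (k : ℕ) :
    d.choose k * n ^ k ≤ n.choose k * d ^ k := by
  have key : d.descFactorial k * n ^ k ≤ n.descFactorial k * d ^ k := by
    induction k with
    | zero => simp
    | succ k ih =>
      have h1 : (d - k) * n ≤ (n - k) * d := by
        rw [Nat.sub_mul, Nat.sub_mul, Nat.mul_comm d n]
        exact Nat.sub_le_sub_left (Nat.mul_le_mul_left k h) _
      calc d.descFactorial (k + 1) * n ^ (k + 1)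
          = ((d - k) * n) * (d.descFactorial k * n ^ k) := by
            rw [Nat.descFactorial_succ]; ring
        _ ≤ ((n - k) * d) * (n.descFactorial k * d ^ k) := Nat.mul_le_mul h1 ih
        _ = n.descFactorial (k + 1) * d ^ (k + 1) := by
            rw [Nat.descFactorial_succ]; ring
  rw [Nat.descFactorial_eq_factorial_mul_choose, Nat.descFactorial_eq_factorial_mul_choose,
    mul_assoc, mul_assoc] at key
  exact Nat.le_of_mul_le_mul_left key k.factorial_pos

/-- The generating function of the hypergeometric distribution is dominated by that of the
binomial distribution with the same mean. -/
theorem Finset.sum_powersetCard_one_add_pow_card_inter_le {α : Type*} [DecidableEq α]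
    {S T : Finset α} (hT : T ⊆ S) (hS : S.Nonempty) (l : ℕ) {y : ℝ} (hy : 0 ≤ y) :
    ∑ A ∈ S.powersetCard l, (1 + y) ^ (A ∩ T).card ≤
      S.card.choose l * (1 + y * (T.card / S.card)) ^ l := by
  have hn : (0 : ℝ) < S.card := by exact_mod_cast hS.card_pos
  have expand (A : Finset α) : (1 + y) ^ (A ∩ T).card =
      ∑ B ∈ T.powerset, if B ⊆ A then y ^ B.card else 0 := by
    rw [← Finset.sum_filter]
    have : T.powerset.filter (· ⊆ A) = (A ∩ T).powerset := by
      ext B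
      simp only [Finset.mem_filter, Finset.mem_powerset, Finset.subset_inter_iff]
      tauto
    rw [this, add_comm, ← Finset.sum_pow_mul_eq_add_pow]
    simp
  have count (B : Finset α) (hB : B ∈ T.powerset) :
      (∑ A ∈ S.powersetCard l, if B ⊆ A then y ^ B.card else 0) ≤
        (S.card.choose l : ℝ) * (l.choose B.card * (T.card / S.card : ℝ) ^ B.card /
          T.card.choose B.card) * y ^ B.card := by
    rw [Finset.mem_powerset] at hB
    rw [← Finset.sum_filter, Finset.sum_const, nsmul_eq_mul]
    refine mul_le_mul_of_nonneg_right ?_ (by positivity)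
    by_cases hl : B.card ≤ l
    · rw [Finset.card_filter_powersetCard_subset B S l (hB.trans hT) hl, ← mul_div_assoc,
        le_div_iff₀ (by exact_mod_cast Nat.choose_pos (Finset.card_le_card hB)), div_pow,
        ← mul_div_assoc, ← mul_div_assoc, le_div_iff₀ (by positivity)]
      have h1 := Nat.choose_mul_pow_le_choose_mul_pow (Finset.card_le_card hT) B.card
      have h2 := Nat.choose_mul (n := S.card) hl
      have h3 : (S.card - B.card).choose (l - B.card) * T.card.choose B.card * S.card ^ B.card ≤
          S.card.choose l * (l.choose B.card * T.card ^ B.card) := by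
        rw [← mul_assoc, h2]
        calc _ = (S.card - B.card).choose (l - B.card) *
              (T.card.choose B.card * S.card ^ B.card) := by ring
          _ ≤ _ := Nat.mul_le_mul_left _ h1
          _ = _ := by ring
      exact_mod_cast h3
    · rw [Finset.filter_eq_empty_iff.2, Finset.card_empty, Nat.cast_zero]
      · positivity
      · intro A hA hBA
        exact hl ((Finset.card_le_card hBA).trans_eq (Finset.mem_powersetCard.1 hA).2)
  set g : ℕ → ℝ := fun k => S.card.choose l * (l.choose k * (y * (T.card / S.card : ℝ)) ^ k)
  have hg (k : ℕ) : 0 ≤ g k := by positivity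
  calc ∑ A ∈ S.powersetCard l, (1 + y) ^ (A ∩ T).card
      = ∑ B ∈ T.powerset, ∑ A ∈ S.powersetCard l, if B ⊆ A then y ^ B.card else 0 := by
        rw [Finset.sum_comm]
        exact Finset.sum_congr rfl fun A _ => expand A
    _ ≤ ∑ B ∈ T.powerset, (S.card.choose l : ℝ) * (l.choose B.card *
          (T.card / S.card : ℝ) ^ B.card / T.card.choose B.card) * y ^ B.card :=
        Finset.sum_le_sum count
    _ = ∑ k ∈ Finset.range (T.card + 1), g k := by
        rw [Finset.sum_powerset_apply_card (fun k => (S.card.choose l : ℝ) * (l.choose k *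
          (T.card / S.card : ℝ) ^ k / T.card.choose k) * y ^ k)]
        refine Finset.sum_congr rfl fun k hk => ?_
        have : (T.card.choose k : ℝ) ≠ 0 := by
          exact_mod_cast (Nat.choose_pos (Nat.lt_succ_iff.1 (Finset.mem_range.1 hk))).ne'
        simp only [g, nsmul_eq_mul, mul_pow]
        field_simp
    _ ≤ ∑ k ∈ Finset.range (T.card + 1 + (l + 1)), g k :=
        Finset.sum_le_sum_of_subset_of_nonneg
          (Finset.range_subset_range.2 (by omega)) fun k _ _ => hg k
    _ = ∑ k ∈ Finset.range (l + 1), g k := by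
        refine (Finset.sum_subset (Finset.range_subset_range.2 (by omega)) fun k _ hk => ?_).symm
        have : l.choose k = 0 := Nat.choose_eq_zero_of_lt (by simpa using hk)
        simp [g, this]
    _ = S.card.choose l * (1 + y * (T.card / S.card)) ^ l := by
        rw [add_comm (1 : ℝ), add_pow, Finset.mul_sum]
        refine Finset.sum_congr rfl fun k _ => ?_
        simp only [g, one_pow]
        ring

/-- Hoeffding's lemma for a Bernoulli random variable. -/
theorem one_add_exp_sub_one_mul_le {q : ℝ} (hq0 : 0 ≤ q) (hq1 : q ≤ 1) (s : ℝ) :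
    1 + (Real.exp s - 1) * q ≤ Real.exp (s * q + s ^ 2 / 8) := by
  have hb : ∀ᵐ x ∂ProbabilityTheory.bernoulliMeasure (1 : ℝ) 0 ⟨q, hq0, hq1⟩,
      id x ∈ Set.Icc (0 : ℝ) 1 := by
    rw [ProbabilityTheory.bernoulliMeasure_def, MeasureTheory.ae_add_measure_iff]
    constructor <;> refine MeasureTheory.Measure.ae_smul_measure ?_ _ <;>
      simp [MeasureTheory.ae_dirac_eq]
  have h := (ProbabilityTheory.hasSubgaussianMGF_of_mem_Icc aemeasurable_id hb).mgf_le s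
  simp [ProbabilityTheory.mgf, ProbabilityTheory.integral_bernoulliMeasure] at h
  calc 1 + (Real.exp s - 1) * q
      = Real.exp (s * q) * (q * Real.exp (s * (1 - q)) + (1 - q) * Real.exp (-(s * q))) := by
        have h1 : Real.exp s = Real.exp (s * q) * Real.exp (s * (1 - q)) := by
          rw [← Real.exp_add]; ring_nf
        have h2 : Real.exp (s * q) * Real.exp (-(s * q)) = 1 := by
          rw [← Real.exp_add, add_neg_cancel, Real.exp_zero]
        linear_combination q * h1 - (1 - q) * h2
    _ ≤ Real.exp (s * q) * Real.exp ((2 ^ 2)⁻¹ * s ^ 2 / 2) := by gcongr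
    _ = Real.exp (s * q + s ^ 2 / 8) := by rw [← Real.exp_add]; ring_nf

/-- Moment generating function bound for the size of the intersection of a fixed set with a
uniformly random set of size `l`. -/
theorem Finset.sum_powersetCard_exp_card_inter_le {α : Type*} [DecidableEq α]
    {S T : Finset α} (hT : T ⊆ S) (hS : S.Nonempty) (l : ℕ) {s : ℝ} (hs : 0 ≤ s) :
    ∑ A ∈ S.powersetCard l, Real.exp (s * (A ∩ T).card) ≤
      S.card.choose l * Real.exp (l * (s * (T.card / S.card) + s ^ 2 / 8)) := by
  have hn : (0 : ℝ) < S.card := by exact_mod_cast hS.card_pos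
  have hq : (T.card / S.card : ℝ) ≤ 1 :=
    (div_le_one hn).2 (by exact_mod_cast Finset.card_le_card hT)
  have hy : 0 ≤ Real.exp s - 1 := sub_nonneg.2 (Real.one_le_exp hs)
  calc ∑ A ∈ S.powersetCard l, Real.exp (s * (A ∩ T).card)
      = ∑ A ∈ S.powersetCard l, (1 + (Real.exp s - 1)) ^ (A ∩ T).card := by
        refine Finset.sum_congr rfl fun A _ => ?_
        rw [add_sub_cancel, ← Real.exp_nat_mul, mul_comm]
    _ ≤ S.card.choose l * (1 + (Real.exp s - 1) * (T.card / S.card)) ^ l :=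
        Finset.sum_powersetCard_one_add_pow_card_inter_le hT hS l hy
    _ ≤ S.card.choose l * Real.exp (s * (T.card / S.card) + s ^ 2 / 8) ^ l := by
        gcongr
        exact one_add_exp_sub_one_mul_le (by positivity) hq s
    _ = _ := by rw [← Real.exp_nat_mul]


open Classical in
theorem degree_concentration_random_subset (ε : ℝ) (hε0 : 0 < ε) (hε1 : ε < 1) :
    ∃ n₀ ℓ₀ : ℕ, ∀ n : ℕ, n₀ ≤ n → ∀ ℓ : ℕ, ℓ₀ ≤ ℓ → ℓ ≤ n →
    ∀ Adj : Fin n → Fin n → Prop,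
      (∀ a b : Fin n,
        (1 + ε) * n ≤ ((Finset.univ.filter fun b' => Adj a b').card : ℝ) +
          ((Finset.univ.filter fun a' => Adj a' b).card : ℝ)) →
    ∀ v u : Fin n,
      -- probability over a uniformly random `A` with `|A ∩ V₁| = |A ∩ V₂| = ℓ`
      -- (encoded as a pair `(A₁, A₂)` of `ℓ`-subsets) that
      -- `deg(v, A) + deg(u, A) < (1 + ε/2)ℓ`
      ((((Finset.powersetCard ℓ (Finset.univ : Finset (Fin n))) ×ˢ
          (Finset.powersetCard ℓ (Finset.univ : Finset (Fin n)))).filter fun A =>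
            ((A.2.filter fun b => Adj v b).card : ℝ) +
              ((A.1.filter fun a => Adj a u).card : ℝ) < (1 + ε / 2) * ℓ).card : ℝ) /
        ((((Finset.powersetCard ℓ (Finset.univ : Finset (Fin n))) ×ˢ
          (Finset.powersetCard ℓ (Finset.univ : Finset (Fin n)))).card : ℝ)) ≤
      2 * Real.exp (-((ℓ : ℝ) * ε ^ 2 / 4)) := by
  refine ⟨1, 0, fun n hn l _ hl Adj hdeg v u => ?_⟩
  have hn0 : (0 : ℝ) < n := by exact_mod_cast hn
  have hne : (Finset.univ : Finset (Fin n)).Nonempty := ⟨v, Finset.mem_univ v⟩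
  set P := Finset.powersetCard l (Finset.univ : Finset (Fin n)) with hP
  set T₁ := Finset.univ.filter fun a => ¬ Adj a u with hT₁
  set T₂ := Finset.univ.filter fun b => ¬ Adj v b with hT₂
  have hPc : P.card = n.choose l := by simp [hP]
  have hC : (0 : ℝ) < n.choose l := by exact_mod_cast Nat.choose_pos hl
  have hcompl (A : Finset (Fin n)) (p : Fin n → Prop) :
      ((A.filter p).card : ℝ) + (A ∩ Finset.univ.filter fun a => ¬ p a).card = A.card := by
    rw [Finset.inter_filter, Finset.inter_univ]
    exact_mod_cast Finset.card_filter_add_card_filter_not p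
  have hT : (T₁.card / n + T₂.card / n : ℝ) ≤ 1 - ε := by
    have h1 := hcompl Finset.univ (Adj v)
    have h2 := hcompl Finset.univ (Adj · u)
    rw [Finset.univ_inter, Finset.card_univ, Fintype.card_fin] at h1 h2
    have h3 := hdeg v u
    rw [← add_div, div_le_iff₀ hn0]
    linarith
  have m₁ := Finset.sum_powersetCard_exp_card_inter_le (Finset.subset_univ T₁) hne l hε0.le
  have m₂ := Finset.sum_powersetCard_exp_card_inter_le (Finset.subset_univ T₂) hne l hε0.le
  rw [Finset.card_univ, Fintype.card_fin, ← hP] at m₁ m₂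
  rw [Finset.card_product, hPc, Nat.cast_mul, div_le_iff₀ (by positivity)]
  calc _ ≤ ∑ A ∈ P ×ˢ P, Real.exp (ε * (A.1 ∩ T₁).card) * Real.exp (ε * (A.2 ∩ T₂).card) *
          Real.exp (-(ε * ((1 - ε / 2) * l))) := by
        rw [Finset.card_filter, Nat.cast_sum]
        refine Finset.sum_le_sum fun A hA => ?_
        split_ifs with h
        · rw [Nat.cast_one, ← Real.exp_add, ← Real.exp_add]
          rw [Finset.mem_product, hP, Finset.mem_powersetCard, Finset.mem_powersetCard] at hA
          have h1 := hcompl A.1 (Adj · u)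
          have h2 := hcompl A.2 (Adj v)
          rw [hA.1.2] at h1
          rw [hA.2.2] at h2
          refine Real.one_le_exp ?_
          rw [← mul_add, ← sub_eq_add_neg, ← mul_sub]
          exact mul_nonneg hε0.le (by linarith)
        · rw [Nat.cast_zero]
          positivity
    _ = (∑ A ∈ P, Real.exp (ε * (A ∩ T₁).card)) * (∑ A ∈ P, Real.exp (ε * (A ∩ T₂).card)) *
          Real.exp (-(ε * ((1 - ε / 2) * l))) := by
        rw [← Finset.sum_mul, Finset.sum_mul_sum, Finset.sum_product]
    _ ≤ (n.choose l * Real.exp (l * (ε * (T₁.card / n) + ε ^ 2 / 8))) *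
          (n.choose l * Real.exp (l * (ε * (T₂.card / n) + ε ^ 2 / 8))) *
          Real.exp (-(ε * ((1 - ε / 2) * l))) := by
        gcongr
    _ = Real.exp (l * (ε * (T₁.card / n + T₂.card / n) - ε + 3 * ε ^ 2 / 4)) *
          (n.choose l * n.choose l) := by
        have : (l * (ε * (T₁.card / n + T₂.card / n) - ε + 3 * ε ^ 2 / 4) : ℝ) =
          l * (ε * (T₁.card / n) + ε ^ 2 / 8) + l * (ε * (T₂.card / n) + ε ^ 2 / 8) +
            -(ε * ((1 - ε / 2) * l)) := by ring
        rw [this, Real.exp_add, Real.exp_add]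
        ring
    _ ≤ Real.exp (-(l * ε ^ 2 / 4)) * (n.choose l * n.choose l) := by
        gcongr
        have := mul_le_mul_of_nonneg_left hT hε0.le
        calc (l * (ε * (T₁.card / n + T₂.card / n) - ε + 3 * ε ^ 2 / 4) : ℝ)
            ≤ l * (ε * (1 - ε) - ε + 3 * ε ^ 2 / 4) := by gcongr
          _ = _ := by ring
    _ ≤ 2 * Real.exp (-(l * ε ^ 2 / 4)) * (n.choose l * n.choose l) := by
        gcongr
        linarith [Real.exp_pos (-(l * ε ^ 2 / 4))]
end
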